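/- arXiv:2204.08752 — 5 statements merged into one kernel-verified Lean document; each statement's English description precedes it below -/
import Mathlib

section
/- Let θ satisfy arctan(1/2) ≤ θ < π/2. With I = [0,2]×[0,1] and Ω₂(θ) = {(x₁,x₂) ∈ I : (x₁−1)·tan θ + x₂ ≥ 1/2}, one has ∫_I λ(Ω₂(θ) ∩ [0,x])² dx = 1/9 − 1/(24·tanθ) + 1/(120·tan²θ) + 1/(1440·tan³θ). -/
open MeasureTheory Real Set

noncomputable section

/-- The rectangle `I = [0,2] × [0,1] ⊆ ℝ²`. -/
def I2 : Set (ℝ × ℝ) := Set.Icc (0 : ℝ) 2 ×ˢ Set.Icc (0 : ℝ) 1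

/-- The squared `L₂`-discrepancy over a set `K ⊆ ℝ²` of a point configuration `P`:
`∫_K (λ((-∞,x] ∩ K)/λ(K) - (1/N) #{i : P i ∈ (-∞,x]})² dx`. -/
def L2sqOn (K : Set (ℝ × ℝ)) {ι : Type} [Fintype ι] (P : ι → ℝ × ℝ) : ℝ :=
  ∫ x in K,
    ((volume (Set.Iic x ∩ K)).toReal / (volume K).toReal
      - (Fintype.card ι : ℝ)⁻¹ * (Nat.card {i // P i ∈ Set.Iic x} : ℝ)) ^ 2

/-- Expected squared `L₂`-discrepancy over `K ⊆ ℝ²` of the stratified sample from the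
partition `Ω` of `K`: the points are independent, the `i`-th uniformly distributed on `Ω i`. -/
def expL2sqOn (K : Set (ℝ × ℝ)) {ι : Type} [Fintype ι] (Ω : ι → Set (ℝ × ℝ)) : ℝ :=
  ∫ P, L2sqOn K P ∂(Measure.pi fun i => ProbabilityTheory.cond volume (Ω i))

end

/-- The derivative of the squared positive part is twice the positive part. -/
theorem hasDerivAt_max_zero_sq (z : ℝ) :
    HasDerivAt (fun z : ℝ => max z 0 ^ 2) (2 * max z 0) z := by
  rcases lt_trichotomy z 0 with hz | rfl | hz
  · rw [max_eq_right hz.le, mul_zero]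
    refine (hasDerivAt_const z (0 : ℝ)).congr_of_eventuallyEq ?_
    filter_upwards [Iio_mem_nhds hz] with w hw
    simp [max_eq_right (le_of_lt (mem_Iio.1 hw))]
  · rw [max_self, mul_zero, hasDerivAt_iff_isLittleO]
    simp only [max_self, sub_zero, smul_zero, ne_eq, OfNat.ofNat_ne_zero, not_false_eq_true,
      zero_pow]
    refine Asymptotics.IsBigO.trans_isLittleO (g := fun z : ℝ => z ^ 2) ?_ ?_
    · refine Asymptotics.isBigO_of_le _ fun w => ?_
      rw [norm_pow, norm_pow]
      refine pow_le_pow_left₀ (norm_nonneg _) ?_ 2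
      simpa using abs_max_le_max_abs_abs (a := w) (b := 0)
    · simpa using Asymptotics.isLittleO_pow_id (𝕜 := ℝ) one_lt_two
  · rw [max_eq_left hz.le]
    refine HasDerivAt.congr_of_eventuallyEq (f := fun w : ℝ => w ^ 2) ?_ ?_
    · simpa using hasDerivAt_pow 2 z
    · filter_upwards [Ioi_mem_nhds hz] with w hw
      simp [max_eq_left (le_of_lt (mem_Ioi.1 hw))]

/-- The integral of the positive part of an affine function with slope `c`. -/
theorem integral_max_add_mul_zero {c : ℝ} (hc : 0 < c) (u y : ℝ) :
    ∫ s in (0 : ℝ)..y, max (u + c * s) 0 = (max (u + c * y) 0 ^ 2 - max u 0 ^ 2) / (2 * c) := by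
  have hderiv : ∀ s ∈ uIcc 0 y,
      HasDerivAt (fun s => max (u + c * s) 0 ^ 2 / (2 * c)) (max (u + c * s) 0) s := by
    intro s _
    have h := ((hasDerivAt_max_zero_sq (u + c * s)).comp s
      (((hasDerivAt_id s).const_mul c).const_add u)).div_const (2 * c)
    refine h.congr_deriv ?_
    field_simp
  rw [intervalIntegral.integral_eq_sub_of_hasDerivAt hderiv
    (Continuous.intervalIntegrable (by fun_prop) _ _)]
  simp only [mul_zero, add_zero]
  ring

/-- The area of the part of the trapezoid lying below and to the left of a point of the rectangle,
in terms of the inverse slope `c`. -/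
theorem volume_trapezoid_inter_box {c : ℝ} (hc : 0 < c) (hc2 : c ≤ 2) {x : ℝ × ℝ} (hx : x ∈ I2) :
    (volume ({p ∈ I2 | 1 / 2 ≤ (p.1 - 1) * c⁻¹ + p.2} ∩ Icc 0 x)).toReal
      = (max (x.1 - 1 - c / 2 + c * x.2) 0 ^ 2 - max (x.1 - 1 - c / 2) 0 ^ 2) / (2 * c) := by
  obtain ⟨⟨hx1, hx1'⟩, hx2, hx2'⟩ := hx
  have hset : {p ∈ I2 | 1 / 2 ≤ (p.1 - 1) * c⁻¹ + p.2} ∩ Icc 0 x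
      = {p : ℝ × ℝ | p.2 ∈ Icc 0 x.2 ∧ p.1 ∈ Icc (1 + c / 2 - c * p.2) x.1} := by
    ext ⟨a, b⟩
    have key : 1 / 2 ≤ (a - 1) * c⁻¹ + b ↔ 1 + c / 2 - c * b ≤ a := by
      rw [← div_eq_mul_inv, ← sub_le_iff_le_add, le_div_iff₀ hc]
      constructor <;> intro h <;> linarith
    simp only [I2, mem_inter_iff, mem_ofPred_eq, mem_prod, mem_Icc, Prod.le_def, Prod.fst_zero,
      Prod.snd_zero, key]
    constructor
    · rintro ⟨⟨⟨⟨_, _⟩, _, _⟩, h⟩, ⟨_, _⟩, _, _⟩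
      exact ⟨⟨by assumption, by assumption⟩, h, by assumption⟩
    · rintro ⟨⟨hb, hb'⟩, ha, ha'⟩
      have ha0 : 0 ≤ a := by nlinarith
      refine ⟨⟨⟨⟨ha0, by linarith⟩, hb, by linarith⟩, ha⟩, ⟨ha0, hb⟩, ha', hb'⟩
  have hmeas : MeasurableSet
      {p : ℝ × ℝ | p.2 ∈ Icc 0 x.2 ∧ p.1 ∈ Icc (1 + c / 2 - c * p.2) x.1} := by
    refine IsClosed.measurableSet ?_
    have h : IsClosed {p : ℝ × ℝ | 1 + c / 2 - c * p.2 ≤ p.1} :=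
      isClosed_le (by fun_prop) continuous_fst
    exact (isClosed_Icc.preimage continuous_snd).inter
      (h.inter (isClosed_Iic.preimage continuous_fst))
  have hslice : ∀ b : ℝ, volume ((fun a : ℝ => (a, b)) ⁻¹'
      {p : ℝ × ℝ | p.2 ∈ Icc 0 x.2 ∧ p.1 ∈ Icc (1 + c / 2 - c * p.2) x.1})
      = (Icc 0 x.2).indicator
        (fun b => ENNReal.ofReal (max (x.1 - 1 - c / 2 + c * b) 0)) b := by
    intro b
    by_cases hb : b ∈ Icc 0 x.2
    · rw [indicator_of_mem hb]
      have : (fun a : ℝ => (a, b)) ⁻¹'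
          {p : ℝ × ℝ | p.2 ∈ Icc 0 x.2 ∧ p.1 ∈ Icc (1 + c / 2 - c * p.2) x.1}
          = Icc (1 + c / 2 - c * b) x.1 := by
        ext a
        simp [hb.1, hb.2]
      rw [this, Real.volume_Icc, ENNReal.ofReal_max, ENNReal.ofReal_zero, max_eq_left zero_le]
      congr 1
      ring
    · rw [indicator_of_notMem hb]
      convert measure_empty (μ := (volume : Measure ℝ))
      ext a
      simp only [mem_preimage, mem_ofPred_eq, hb, false_and, mem_empty_iff_false]
  rw [hset, Measure.volume_eq_prod, Measure.prod_apply_symm hmeas]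
  simp_rw [hslice]
  rw [lintegral_indicator measurableSet_Icc, ← ofReal_integral_eq_lintegral_ofReal
      (f := fun b => max (x.1 - 1 - c / 2 + c * b) 0)
      (Continuous.integrableOn_Icc (by fun_prop))
      (Filter.Eventually.of_forall fun _ => le_max_right _ _),
    ENNReal.toReal_ofReal
      (integral_nonneg (f := fun b => max (x.1 - 1 - c / 2 + c * b) 0) fun _ => le_max_right _ _),
    integral_Icc_eq_integral_Ioc, ← intervalIntegral.integral_of_le hx2,
    integral_max_add_mul_zero hc]

/-- The horizontal slice at height `y` of the integral of the squared area. -/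
theorem integral_sq_area_slice {c : ℝ} (hc : 0 < c) (hc2 : c ≤ 2) {y : ℝ} (hy : y ∈ Icc (0 : ℝ) 1) :
    ∫ x in (0 : ℝ)..2,
        ((max (x - 1 - c / 2 + c * y) 0 ^ 2 - max (x - 1 - c / 2) 0 ^ 2) / (2 * c)) ^ 2
      = c ^ 3 * y ^ 5 / 20 + y ^ 2 * (1 - c / 2) ^ 3 / 3 + c * y ^ 3 * (1 - c / 2) ^ 2 / 2
        + c ^ 2 * y ^ 4 * (1 - c / 2) / 4 := by
  obtain ⟨hy0, hy1⟩ := hy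
  have hcy : 0 ≤ c * y := by positivity
  have hcy' : c * y ≤ c := by nlinarith
  have hint : ∀ a b : ℝ, IntervalIntegrable (fun x : ℝ =>
      ((max (x - 1 - c / 2 + c * y) 0 ^ 2 - max (x - 1 - c / 2) 0 ^ 2) / (2 * c)) ^ 2)
      volume a b := fun a b => Continuous.intervalIntegrable (by fun_prop) a b
  rw [← intervalIntegral.integral_add_adjacent_intervals (hint 0 (1 + c / 2 - c * y)) (hint _ 2),
    ← intervalIntegral.integral_add_adjacent_intervals
      (hint (1 + c / 2 - c * y) (1 + c / 2)) (hint _ 2)]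
  have hleft : ∫ x in (0 : ℝ)..(1 + c / 2 - c * y),
      ((max (x - 1 - c / 2 + c * y) 0 ^ 2 - max (x - 1 - c / 2) 0 ^ 2) / (2 * c)) ^ 2 = 0 := by
    refine intervalIntegral.integral_zero_ae (Filter.Eventually.of_forall fun x hx => ?_)
    rw [uIoc_of_le (by linarith)] at hx
    rw [max_eq_right (by linarith [hx.2]), max_eq_right (by linarith [hx.2])]
    simp
  have hmid : ∫ x in (1 + c / 2 - c * y)..(1 + c / 2),
      ((max (x - 1 - c / 2 + c * y) 0 ^ 2 - max (x - 1 - c / 2) 0 ^ 2) / (2 * c)) ^ 2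
      = c ^ 3 * y ^ 5 / 20 := by
    have hcongr : EqOn (fun x : ℝ =>
        ((max (x - 1 - c / 2 + c * y) 0 ^ 2 - max (x - 1 - c / 2) 0 ^ 2) / (2 * c)) ^ 2)
        (fun x => (x - (1 + c / 2 - c * y)) ^ 4 / (4 * c ^ 2))
        (uIcc (1 + c / 2 - c * y) (1 + c / 2)) := by
      intro x hx
      rw [uIcc_of_le (by linarith)] at hx
      simp only
      rw [max_eq_left (by linarith [hx.1]), max_eq_right (by linarith [hx.2])]
      field_simp
      ring
    rw [intervalIntegral.integral_congr hcongr, intervalIntegral.integral_div,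
      intervalIntegral.integral_comp_sub_right (fun x => x ^ 4), integral_pow]
    field_simp
    ring
  have hright : ∫ x in (1 + c / 2)..2,
      ((max (x - 1 - c / 2 + c * y) 0 ^ 2 - max (x - 1 - c / 2) 0 ^ 2) / (2 * c)) ^ 2
      = y ^ 2 * (1 - c / 2) ^ 3 / 3 + c * y ^ 3 * (1 - c / 2) ^ 2 / 2
        + c ^ 2 * y ^ 4 * (1 - c / 2) / 4 := by
    have hcongr : EqOn (fun x : ℝ =>
        ((max (x - 1 - c / 2 + c * y) 0 ^ 2 - max (x - 1 - c / 2) 0 ^ 2) / (2 * c)) ^ 2)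
        (fun x => y ^ 2 * (x - (1 + c / 2) + c * y / 2) ^ 2) (uIcc (1 + c / 2) 2) := by
      intro x hx
      rw [uIcc_of_le (by linarith)] at hx
      simp only
      rw [max_eq_left (by linarith [hx.1]), max_eq_left (by linarith [hx.1])]
      field_simp
      ring
    rw [intervalIntegral.integral_congr hcongr, intervalIntegral.integral_const_mul,
      intervalIntegral.integral_comp_sub_right (fun x => (x + c * y / 2) ^ 2),
      intervalIntegral.integral_comp_add_right (fun x => x ^ 2), integral_pow]
    push_cast
    ring
  rw [hleft, hmid, hright]
  ring

/-- The integral of the squared area, in terms of the inverse slope `c`. -/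
theorem integral_volume_trapezoid_inter_box_sq {c : ℝ} (hc : 0 < c) (hc2 : c ≤ 2) :
    ∫ x in I2, ((volume ({p ∈ I2 | 1 / 2 ≤ (p.1 - 1) * c⁻¹ + p.2} ∩ Icc 0 x)).toReal) ^ 2
      = 1 / 9 - c / 24 + c ^ 2 / 120 + c ^ 3 / 1440 := by
  have hI2 : MeasurableSet I2 := measurableSet_Icc.prod measurableSet_Icc
  rw [setIntegral_congr_fun hI2 fun x hx => by
    simp only [volume_trapezoid_inter_box hc hc2 hx]; rfl]
  rw [I2, Measure.volume_eq_prod, ← setIntegral_prod_swap, setIntegral_prod]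
  · simp only [Prod.swap_prod_mk]
    have hslice : EqOn (fun y : ℝ => ∫ x in Icc (0 : ℝ) 2,
        ((max (x - 1 - c / 2 + c * y) 0 ^ 2 - max (x - 1 - c / 2) 0 ^ 2) / (2 * c)) ^ 2)
        (fun y => c ^ 3 / 20 * y ^ 5 + (1 - c / 2) ^ 3 / 3 * y ^ 2
          + c * (1 - c / 2) ^ 2 / 2 * y ^ 3 + c ^ 2 * (1 - c / 2) / 4 * y ^ 4)
        (Icc 0 1) := by
      intro y hy
      simp only
      rw [integral_Icc_eq_integral_Ioc, ← intervalIntegral.integral_of_le zero_le_two,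
        integral_sq_area_slice hc hc2 hy]
      ring
    rw [setIntegral_congr_fun measurableSet_Icc hslice, integral_Icc_eq_integral_Ioc,
      ← intervalIntegral.integral_of_le zero_le_one]
    rw [intervalIntegral.integral_add, intervalIntegral.integral_add, intervalIntegral.integral_add]
    · simp only [intervalIntegral.integral_const_mul, integral_pow]
      push_cast
      ring
    all_goals exact Continuous.intervalIntegrable (by fun_prop) _ _
  · rw [← Measure.volume_eq_prod]
    refine ContinuousOn.integrableOn_compact (isCompact_Icc.prod isCompact_Icc) ?_
    exact Continuous.continuousOn (by fun_prop)

/-- For `arctan (1/2) ≤ θ < π/2` and the trapezoid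
`Ω₂(θ) = {(x₁,x₂) ∈ I : (x₁-1)·tan θ + x₂ ≥ 1/2}` of `I = [0,2] × [0,1]`:
`∫_I λ(Ω₂(θ) ∩ [0,x])² dx = 1/9 - 1/(24 tan θ) + 1/(120 tan² θ) + 1/(1440 tan³ θ)`. -/
theorem integral_measure_trapezoid2_inter_box_sq (θ : ℝ)
    (h1 : arctan (1 / 2) ≤ θ) (h2 : θ < π / 2) :
    ∫ x in I2, ((volume ({p ∈ I2 | 1 / 2 ≤ (p.1 - 1) * tan θ + p.2} ∩ Set.Icc 0 x)).toReal) ^ 2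
      = 1 / 9 - 1 / (24 * tan θ) + 1 / (120 * tan θ ^ 2) + 1 / (1440 * tan θ ^ 3) := by
  have htan : 1 / 2 ≤ tan θ := by
    rw [← tan_arctan (1 / 2)]
    exact strictMonoOn_tan.monotoneOn (arctan_mem_Ioo _)
      ⟨(neg_pi_div_two_lt_arctan _).trans_le h1, h2⟩ h1
  have hpos : 0 < tan θ := by linarith
  have hle : (tan θ)⁻¹ ≤ 2 := by
    rw [inv_le_comm₀ hpos two_pos]
    linarith
  have h := integral_volume_trapezoid_inter_box_sq (inv_pos.2 hpos) hle
  rw [inv_inv] at h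
  rw [h]
  field_simp
end

section
/- Let θ satisfy 0 ≤ θ < arctan(1/2). With I = [0,2]×[0,1] and Ω'₁(θ) = {(x₁,x₂) ∈ I : x₂ ≤ (1−x₁)·tanθ + 1/2}, one has ∫_I λ(Ω'₁(θ) ∩ [0,x])² dx = 4/9 + (1/3)·tanθ − (4/15)·tan²θ − (4/45)·tan³θ. -/
open MeasureTheory Real Set

/-- The area of the part of a box `[0,x]` under the graph of a continuous nonnegative function
is the integral of the truncation of that function at height `x.2`. -/
theorem toReal_volume_subgraph_inter_box (f : ℝ → ℝ) (hf : Continuous f) (x : ℝ × ℝ)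
    (hx : x ∈ I2) (hf0 : ∀ u ∈ Icc (0 : ℝ) 2, 0 ≤ f u) :
    (volume ({p ∈ I2 | p.2 ≤ f p.1} ∩ Icc 0 x)).toReal = ∫ u in (0)..x.1, min x.2 (f u) := by
  obtain ⟨a, b⟩ := x
  obtain ⟨⟨ha0, ha2⟩, hb0, hb1⟩ := hx
  dsimp only at ha0 ha2 hb0 hb1 ⊢
  have hm : MeasurableSet ({p ∈ I2 | p.2 ≤ f p.1} ∩ Icc 0 (a, b)) :=
    ((measurableSet_Icc.prod measurableSet_Icc).inter
      (measurableSet_le measurable_snd (hf.measurable.comp measurable_fst))).inter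
      measurableSet_Icc
  have hslice : ∀ u, volume (Prod.mk u ⁻¹' ({p ∈ I2 | p.2 ≤ f p.1} ∩ Icc 0 (a, b)))
      = (Icc 0 a).indicator (fun u => ENNReal.ofReal (min b (f u))) u := by
    intro u
    by_cases hu : u ∈ Icc 0 a
    · have : Prod.mk u ⁻¹' ({p ∈ I2 | p.2 ≤ f p.1} ∩ Icc 0 (a, b)) = Icc 0 (min b (f u)) := by
        ext v
        simp only [I2, mem_preimage, mem_inter_iff, mem_ofPred_eq, mem_prod, mem_Icc,
          Prod.le_def, Prod.fst_zero, Prod.snd_zero, le_min_iff] at hu ⊢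
        constructor
        · tauto
        · rintro ⟨h0, hb, hfv⟩
          exact ⟨⟨⟨⟨hu.1, hu.2.trans ha2⟩, h0, hb.trans hb1⟩, hfv⟩, ⟨hu.1, h0⟩, hu.2, hb⟩
      rw [indicator_of_mem hu, this, Real.volume_Icc, sub_zero]
    · have : Prod.mk u ⁻¹' ({p ∈ I2 | p.2 ≤ f p.1} ∩ Icc 0 (a, b)) = ∅ := by
        ext v
        simp only [mem_preimage, mem_inter_iff, mem_Icc, Prod.le_def, Prod.fst_zero,
          mem_empty_iff_false, iff_false] at hu ⊢
        tauto
      rw [indicator_of_notMem hu, this, measure_empty]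
  rw [Measure.volume_eq_prod, Measure.prod_apply hm, lintegral_congr hslice,
    lintegral_indicator measurableSet_Icc, intervalIntegral.integral_of_le ha0,
    ← integral_Icc_eq_integral_Ioc, integral_eq_lintegral_of_nonneg_ae]
  · filter_upwards [ae_restrict_mem measurableSet_Icc] with u hu
    exact le_min hb0 (hf0 u ⟨hu.1, hu.2.trans ha2⟩)
  · exact (continuous_const.min hf).aestronglyMeasurable

theorem integral_line (m c a b : ℝ) :
    ∫ u in a..b, ((1 - u) * m + c) = (m + c) * (b - a) - m * (b ^ 2 - a ^ 2) / 2 := by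
  have h : ∀ u ∈ uIcc a b, HasDerivAt (fun u => (m + c) * u - m * u ^ 2 / 2)
      ((1 - u) * m + c) u := fun u _ => by
    refine (((hasDerivAt_id u).const_mul (m + c)).sub
      ((((hasDerivAt_id u).pow 2).const_mul m).div_const 2)).congr_deriv ?_
    simp only [id]
    push_cast
    ring
  rw [intervalIntegral.integral_eq_sub_of_hasDerivAt h
    (Continuous.intervalIntegrable (by fun_prop) _ _)]
  ring

section Truncation

variable {m x y : ℝ}

theorem integral_min_line_of_le (hm : 0 ≤ m) (hx : 0 ≤ x) (hy : y ≤ (1 - x) * m + 1 / 2) :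
    ∫ u in (0)..x, min y ((1 - u) * m + 1 / 2) = x * y := by
  rw [intervalIntegral.integral_congr (g := fun _ => y)]
  · simp
  · intro u hu
    rw [uIcc_of_le hx] at hu
    exact min_eq_left (by nlinarith [mul_le_mul_of_nonneg_right hu.2 hm])

theorem integral_min_line_of_ge (hm : 0 ≤ m) (hx : 0 ≤ x) (hy : m + 1 / 2 ≤ y) :
    ∫ u in (0)..x, min y ((1 - u) * m + 1 / 2) = (m + 1 / 2) * x - m * x ^ 2 / 2 := by
  rw [intervalIntegral.integral_congr (g := fun u => (1 - u) * m + 1 / 2), integral_line]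
  · ring
  · intro u hu
    rw [uIcc_of_le hx] at hu
    exact min_eq_right (by nlinarith [mul_nonneg hu.1 hm])

theorem integral_min_line_of_mem (hm : 0 < m) (hy : (1 - x) * m + 1 / 2 ≤ y)
    (hy' : y ≤ m + 1 / 2) :
    ∫ u in (0)..x, min y ((1 - u) * m + 1 / 2)
      = (m + 1 / 2) * x - m * x ^ 2 / 2 - (m + 1 / 2 - y) ^ 2 / (2 * m) := by
  set c := (m + 1 / 2 - y) / m
  have hcm : c * m = m + 1 / 2 - y := div_mul_cancel₀ _ hm.ne'
  have hc0 : 0 ≤ c := div_nonneg (by linarith) hm.le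
  have hcx : c ≤ x := (div_le_iff₀ hm).2 (by linarith)
  have hi : ∀ a b, IntervalIntegrable (fun u => min y ((1 - u) * m + 1 / 2)) volume a b :=
    fun a b => Continuous.intervalIntegrable (by fun_prop) a b
  rw [← intervalIntegral.integral_add_adjacent_intervals (hi 0 c) (hi c x),
    integral_min_line_of_le hm.le hc0 (by linarith),
    intervalIntegral.integral_congr (a := c) (g := fun u => (1 - u) * m + 1 / 2), integral_line]
  · have hyc : y = m + 1 / 2 - c * m := by linarith
    rw [hyc]
    field_simp
    ring
  · intro u hu
    rw [uIcc_of_le hcx] at hu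
    exact min_eq_right (by nlinarith [mul_le_mul_of_nonneg_right hu.1 hm.le])

theorem integral_sq_integral_min_line (hm : 0 ≤ m) (hm' : m ≤ 1 / 2) (hx : 0 ≤ x)
    (hx' : x ≤ 2) :
    ∫ y in (0)..1, (∫ u in (0)..x, min y ((1 - u) * m + 1 / 2)) ^ 2
      = ((m + 1 / 2) * x - m * x ^ 2 / 2) ^ 2 * (1 / 2 - m + m * x)
        - ((m + 1 / 2) * x - m * x ^ 2 / 2) * m ^ 2 * x ^ 3 / 3 + m ^ 3 * x ^ 5 / 20
        + x ^ 2 * ((1 - x) * m + 1 / 2) ^ 3 / 3 := by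
  have hcont : Continuous fun y : ℝ => (∫ u in (0)..x, min y ((1 - u) * m + 1 / 2)) ^ 2 :=
    (intervalIntegral.continuous_parametric_intervalIntegral_of_continuous'
      (by fun_prop) 0 x).pow 2
  have hi := fun a b => hcont.intervalIntegrable (μ := volume) a b
  have hmx : 0 ≤ m * x := mul_nonneg hm hx
  have hg0 : 0 ≤ (1 - x) * m + 1 / 2 := by nlinarith
  have hgm : (1 - x) * m + 1 / 2 ≤ m + 1 / 2 := by linarith
  have low : ∫ y in (0)..((1 - x) * m + 1 / 2),
      (∫ u in (0)..x, min y ((1 - u) * m + 1 / 2)) ^ 2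
      = x ^ 2 * ((1 - x) * m + 1 / 2) ^ 3 / 3 := by
    rw [intervalIntegral.integral_congr (g := fun y => x ^ 2 * y ^ 2)]
    · rw [intervalIntegral.integral_const_mul, integral_pow]
      norm_num
      ring
    · intro y hy
      rw [uIcc_of_le hg0] at hy
      dsimp only
      rw [integral_min_line_of_le hm hx hy.2, mul_pow]
  have mid : ∫ y in ((1 - x) * m + 1 / 2)..(m + 1 / 2),
      (∫ u in (0)..x, min y ((1 - u) * m + 1 / 2)) ^ 2
      = ((m + 1 / 2) * x - m * x ^ 2 / 2) ^ 2 * (m * x)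
        - ((m + 1 / 2) * x - m * x ^ 2 / 2) * m ^ 2 * x ^ 3 / 3 + m ^ 3 * x ^ 5 / 20 := by
    rcases hm.eq_or_lt with rfl | hpos
    · simp
    set G := (m + 1 / 2) * x - m * x ^ 2 / 2
    rw [intervalIntegral.integral_congr
      (g := fun y => (G - (m + 1 / 2 - y) ^ 2 / (2 * m)) ^ 2)]
    · rw [intervalIntegral.integral_comp_sub_left
        (fun s => (G - s ^ 2 / (2 * m)) ^ 2) (m + 1 / 2)]
      have h : ∀ s ∈ uIcc (m + 1 / 2 - (m + 1 / 2)) (m + 1 / 2 - ((1 - x) * m + 1 / 2)),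
          HasDerivAt (fun s => G ^ 2 * s - G / (3 * m) * s ^ 3 + 1 / (20 * m ^ 2) * s ^ 5)
          ((G - s ^ 2 / (2 * m)) ^ 2) s := fun s _ => by
        refine ((((hasDerivAt_id s).const_mul (G ^ 2)).sub
          (((hasDerivAt_id s).pow 3).const_mul _)).add
          (((hasDerivAt_id s).pow 5).const_mul _)).congr_deriv ?_
        simp only [id]
        field_simp
        push_cast
        ring
      rw [intervalIntegral.integral_eq_sub_of_hasDerivAt h
        (Continuous.intervalIntegrable (by fun_prop) _ _)]
      field_simp
      ring
    · intro y hy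
      rw [uIcc_of_le hgm] at hy
      dsimp only
      rw [integral_min_line_of_mem hpos hy.1 hy.2]
  have high : ∫ y in (m + 1 / 2)..1, (∫ u in (0)..x, min y ((1 - u) * m + 1 / 2)) ^ 2
      = ((m + 1 / 2) * x - m * x ^ 2 / 2) ^ 2 * (1 / 2 - m) := by
    rw [intervalIntegral.integral_congr
      (g := fun _ => ((m + 1 / 2) * x - m * x ^ 2 / 2) ^ 2)]
    · rw [intervalIntegral.integral_const, smul_eq_mul]
      ring
    · intro y hy
      rw [uIcc_of_le (by linarith)] at hy
      dsimp only
      rw [integral_min_line_of_ge hm hx hy.1]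
  rw [← intervalIntegral.integral_add_adjacent_intervals (hi 0 (m + 1 / 2)) (hi _ 1),
    ← intervalIntegral.integral_add_adjacent_intervals (hi 0 ((1 - x) * m + 1 / 2)) (hi _ _),
    low, mid, high]
  ring

end Truncation

theorem continuous_integral_min_line (m : ℝ) :
    Continuous fun x : ℝ × ℝ => ∫ u in (0)..x.1, min x.2 ((1 - u) * m + 1 / 2) :=
  intervalIntegral.continuous_parametric_intervalIntegral_of_continuous
    (f := fun (x : ℝ × ℝ) u => min x.2 ((1 - u) * m + 1 / 2)) (by fun_prop) continuous_fst

theorem integral_slice_polynomial (m : ℝ) :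
    ∫ x in (0)..2, (((m + 1 / 2) * x - m * x ^ 2 / 2) ^ 2 * (1 / 2 - m + m * x)
        - ((m + 1 / 2) * x - m * x ^ 2 / 2) * m ^ 2 * x ^ 3 / 3 + m ^ 3 * x ^ 5 / 20
        + x ^ 2 * ((1 - x) * m + 1 / 2) ^ 3 / 3)
      = 4 / 9 + (1 / 3) * m - (4 / 15) * m ^ 2 - (4 / 45) * m ^ 3 := by
  have h : ∀ x ∈ uIcc (0 : ℝ) 2, HasDerivAt (fun x =>
      ((m + 1 / 2) ^ 2 * (1 / 2 - m) + (m + 1 / 2) ^ 3 / 3) / 3 * x ^ 3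
        - (m + 1 / 2) * m * (1 / 2 - m) / 4 * x ^ 4
        + (m ^ 2 * (1 / 2 - m) / 4 - (m + 1 / 2) * m ^ 2 / 3) / 5 * x ^ 5
        + m ^ 3 / 45 * x ^ 6)
      (((m + 1 / 2) * x - m * x ^ 2 / 2) ^ 2 * (1 / 2 - m + m * x)
        - ((m + 1 / 2) * x - m * x ^ 2 / 2) * m ^ 2 * x ^ 3 / 3 + m ^ 3 * x ^ 5 / 20
        + x ^ 2 * ((1 - x) * m + 1 / 2) ^ 3 / 3) x := fun x _ => by
    refine (((((hasDerivAt_id x).pow 3).const_mul _).sub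
      (((hasDerivAt_id x).pow 4).const_mul _)).add
      (((hasDerivAt_id x).pow 5).const_mul _)).add
      (((hasDerivAt_id x).pow 6).const_mul _) |>.congr_deriv ?_
    simp only [id]
    push_cast
    ring
  rw [intervalIntegral.integral_eq_sub_of_hasDerivAt h
    (Continuous.intervalIntegrable (by fun_prop) _ _)]
  ring

/-- For `0 ≤ θ < arctan (1/2)` and the region
`Ω₁'(θ) = {(x₁,x₂) ∈ I : x₂ ≤ (1-x₁)·tan θ + 1/2}` of `I = [0,2] × [0,1]`:
`∫_I λ(Ω₁'(θ) ∩ [0,x])² dx = 4/9 + (1/3)·tan θ - (4/15)·tan² θ - (4/45)·tan³ θ`. -/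
theorem integral_measure_lower_region_inter_box_sq (θ : ℝ)
    (h1 : 0 ≤ θ) (h2 : θ < arctan (1 / 2)) :
    ∫ x in I2, ((volume ({p ∈ I2 | p.2 ≤ (1 - p.1) * tan θ + 1 / 2} ∩ Set.Icc 0 x)).toReal) ^ 2
      = 4 / 9 + (1 / 3) * tan θ - (4 / 15) * tan θ ^ 2 - (4 / 45) * tan θ ^ 3 := by
  have ht0 : 0 ≤ tan θ :=
    tan_nonneg_of_nonneg_of_le_pi_div_two h1 (h2.trans (arctan_lt_pi_div_two _)).le
  have ht1 : tan θ ≤ 1 / 2 := by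
    rw [← tan_arctan (1 / 2)]
    exact (tan_lt_tan_of_nonneg_of_lt_pi_div_two h1 (arctan_lt_pi_div_two _) h2).le
  generalize tan θ = m at ht0 ht1
  have hmeas : MeasurableSet I2 := measurableSet_Icc.prod measurableSet_Icc
  have hnonneg : ∀ u ∈ Icc (0 : ℝ) 2, 0 ≤ (1 - u) * m + 1 / 2 := fun u hu => by
    nlinarith [mul_le_mul_of_nonneg_right hu.2 ht0]
  rw [setIntegral_congr_fun hmeas fun x hx => congrArg (· ^ 2)
      (toReal_volume_subgraph_inter_box (fun u => (1 - u) * m + 1 / 2) (by fun_prop) x hx hnonneg),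
    I2, Measure.volume_eq_prod, setIntegral_prod, integral_Icc_eq_integral_Ioc,
    ← intervalIntegral.integral_of_le zero_le_two, ← integral_slice_polynomial m]
  · refine intervalIntegral.integral_congr fun x hx => ?_
    rw [uIcc_of_le zero_le_two] at hx
    dsimp only
    rw [integral_Icc_eq_integral_Ioc, ← intervalIntegral.integral_of_le zero_le_one,
      integral_sq_integral_min_line ht0 ht1 hx.1 hx.2]
  · rw [← Measure.volume_eq_prod]
    exact ((continuous_integral_min_line m).pow 2).continuousOn.integrableOn_compact
      (isCompact_Icc.prod isCompact_Icc)
end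

section
/- Let θ satisfy 0 ≤ θ < arctan(1/2). With I = [0,2]×[0,1] and Ω'₂(θ) = {(x₁,x₂) ∈ I : x₂ ≥ (1−x₁)·tanθ + 1/2}, one has ∫_I λ(Ω'₂(θ) ∩ [0,x])² dx = 1/9 − (1/6)·tanθ + (2/15)·tan²θ + (2/45)·tan³θ. -/
open MeasureTheory Real Set

theorem integral_max_zero_pow (n : ℕ) (hn : n ≠ 0) {a b : ℝ} (ha : a ≤ 0) :
    ∫ s in a..b, max 0 s ^ n = max 0 b ^ (n + 1) / (n + 1) := by
  have hint : ∀ a b : ℝ, IntervalIntegrable (fun s : ℝ => max 0 s ^ n) volume a b := fun a b =>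
    (by fun_prop : Continuous fun s : ℝ => max 0 s ^ n).intervalIntegrable a b
  have hneg : ∀ c : ℝ, c ≤ 0 → ∫ s in (0 : ℝ)..c, max 0 s ^ n = 0 := by
    intro c hc
    refine intervalIntegral.integral_zero_ae (Filter.Eventually.of_forall fun s hs => ?_)
    rw [uIoc_of_ge hc] at hs
    rw [max_eq_left hs.2, zero_pow hn]
  rw [← intervalIntegral.integral_add_adjacent_intervals (hint a 0) (hint 0 b),
    intervalIntegral.integral_symm, hneg a ha, neg_zero, zero_add]
  rcases le_total b 0 with hb | hb
  · rw [hneg b hb, max_eq_left hb]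
    simp
  · rw [max_eq_right hb, intervalIntegral.integral_congr (g := fun s => s ^ n), integral_pow]
    · simp
    · intro s hs
      rw [uIcc_of_le hb] at hs
      simp only [max_eq_right hs.1]

theorem integral_max_zero_affine_pow (n : ℕ) (hn : n ≠ 0) {a b c t : ℝ} (ha : c + t * a ≤ 0) :
    ∫ u in a..b, max 0 (c + t * u) ^ n = max 0 (c + t * b) ^ (n + 1) / ((n + 1) * t) := by
  rcases eq_or_ne t 0 with rfl | ht
  · rw [zero_mul, add_zero] at ha
    simp [max_eq_left ha, hn]
  · rw [intervalIntegral.integral_comp_add_mul (fun s => max 0 s ^ n) ht,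
      integral_max_zero_pow n hn ha, smul_eq_mul]
    field_simp

theorem integral_linear_add_quadratic_sq (c t b : ℝ) :
    ∫ x in (0 : ℝ)..b, (c * x + t * x ^ 2 / 2) ^ 2
      = c ^ 2 * b ^ 3 / 3 + c * t * b ^ 4 / 4 + t ^ 2 * b ^ 5 / 20 := by
  have h : ∀ x : ℝ, (c * x + t * x ^ 2 / 2) ^ 2
      = c ^ 2 * x ^ 2 + c * t * x ^ 3 + t ^ 2 / 4 * x ^ 4 := fun x => by ring
  simp_rw [h]
  rw [intervalIntegral.integral_add, intervalIntegral.integral_add]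
  · simp only [intervalIntegral.integral_const_mul, integral_pow]
    norm_num
    ring
  all_goals exact Continuous.intervalIntegrable (by fun_prop) _ _

theorem integral_max_zero_affine_of_nonneg {c t b : ℝ} (hc : 0 ≤ c) (ht : 0 ≤ t) (hb : 0 ≤ b) :
    ∫ u in (0 : ℝ)..b, max 0 (c + t * u) = c * b + t * b ^ 2 / 2 := by
  rw [intervalIntegral.integral_congr (g := fun u => c + t * u),
    intervalIntegral.integral_add (by simp) (Continuous.intervalIntegrable (by fun_prop) _ _),
    intervalIntegral.integral_const_mul, integral_id, intervalIntegral.integral_const, smul_eq_mul]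
  · ring
  · intro u hu
    rw [uIcc_of_le hb] at hu
    exact max_eq_right (add_nonneg hc (mul_nonneg ht hu.1))

theorem integral_sq_primitive_max_zero_of_nonneg {c t : ℝ} (hc : 0 ≤ c) (ht : 0 ≤ t) :
    ∫ x in (0 : ℝ)..2, (∫ u in (0 : ℝ)..x, max 0 (c + t * u)) ^ 2
      = 8 / 3 * c ^ 2 + 4 * t * c + 8 / 5 * t ^ 2 := by
  rw [intervalIntegral.integral_congr (g := fun x => (c * x + t * x ^ 2 / 2) ^ 2),
    integral_linear_add_quadratic_sq]
  · ring
  · intro x hx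
    rw [uIcc_of_le zero_le_two] at hx
    simp only [integral_max_zero_affine_of_nonneg hc ht hx.1]

theorem integral_sq_primitive_max_zero_of_nonpos {c t : ℝ} (hc : c ≤ 0) :
    ∫ x in (0 : ℝ)..2, (∫ u in (0 : ℝ)..x, max 0 (c + t * u)) ^ 2
      = max 0 (c + t * 2) ^ 5 / (20 * t ^ 3) := by
  have h : ∀ x : ℝ, (∫ u in (0 : ℝ)..x, max 0 (c + t * u)) ^ 2
      = max 0 (c + t * x) ^ 4 / (4 * t ^ 2) := by
    intro x
    have := integral_max_zero_affine_pow 1 one_ne_zero (a := 0) (b := x) (c := c) (t := t)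
      (by simpa using hc)
    simp only [pow_one] at this
    rw [this, div_pow]
    norm_num
    ring
  simp_rw [h]
  rw [intervalIntegral.integral_div,
    integral_max_zero_affine_pow 4 four_ne_zero (by simpa using hc), div_div]
  norm_num
  ring

theorem integral_integral_sq_primitive_max_zero {t : ℝ} (ht : 0 ≤ t) (ht' : t < 1 / 2) :
    ∫ y in (0 : ℝ)..1, ∫ x in (0 : ℝ)..2,
      (∫ u in (0 : ℝ)..x, max 0 (y - 1 / 2 - t + t * u)) ^ 2
      = 1 / 9 - (1 / 6) * t + (2 / 15) * t ^ 2 + (2 / 45) * t ^ 3 := by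
  have hcont : Continuous fun y : ℝ => ∫ x in (0 : ℝ)..2,
      (∫ u in (0 : ℝ)..x, max 0 (y - 1 / 2 - t + t * u)) ^ 2 := by
    fun_prop
  rw [← intervalIntegral.integral_add_adjacent_intervals
    (hcont.intervalIntegrable 0 (1 / 2 + t)) (hcont.intervalIntegrable (1 / 2 + t) 1)]
  have hlow : ∫ y in (0 : ℝ)..(1 / 2 + t), ∫ x in (0 : ℝ)..2,
      (∫ u in (0 : ℝ)..x, max 0 (y - 1 / 2 - t + t * u)) ^ 2 = 8 / 15 * t ^ 3 := by
    rw [intervalIntegral.integral_congr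
      (g := fun y => max 0 (t - 1 / 2 + 1 * y) ^ 5 / (20 * t ^ 3)),
      intervalIntegral.integral_div, integral_max_zero_affine_pow 5 (by norm_num) (by linarith)]
    · rw [max_eq_right (by linarith)]
      rcases eq_or_ne t 0 with rfl | ht0
      · simp
      · field_simp
        norm_num
        ring
    · intro y hy
      rw [uIcc_of_le (by linarith)] at hy
      simp only [integral_sq_primitive_max_zero_of_nonpos (show y - 1 / 2 - t ≤ 0 by linarith [hy.2])]
      congr 3
      ring
  have hup : ∫ y in (1 / 2 + t)..1, ∫ x in (0 : ℝ)..2,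
      (∫ u in (0 : ℝ)..x, max 0 (y - 1 / 2 - t + t * u)) ^ 2
      = 8 / 9 * (1 / 2 - t) ^ 3 + 2 * t * (1 / 2 - t) ^ 2 + 8 / 5 * t ^ 2 * (1 / 2 - t) := by
    rw [intervalIntegral.integral_congr (g := fun y => 8 / 3 * (y - (1 / 2 + t)) ^ 2
        + 4 * t * (y - (1 / 2 + t)) + 8 / 5 * t ^ 2),
      intervalIntegral.integral_comp_sub_right
        (fun c => 8 / 3 * c ^ 2 + 4 * t * c + 8 / 5 * t ^ 2),
      intervalIntegral.integral_add, intervalIntegral.integral_add]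
    · rw [intervalIntegral.integral_const_mul (4 * t)]
      simp only [intervalIntegral.integral_const_mul, integral_pow, integral_id,
        intervalIntegral.integral_const, smul_eq_mul]
      norm_num
      ring
    any_goals exact Continuous.intervalIntegrable (by fun_prop) _ _
    intro y hy
    rw [uIcc_of_le (by linarith)] at hy
    simp only [integral_sq_primitive_max_zero_of_nonneg (show 0 ≤ y - 1 / 2 - t by linarith [hy.1]) ht]
    ring
  rw [hlow, hup]
  ring

/-- The area of `{p | t (1 - p.1) + 1/2 ≤ p.2} ∩ [0, x]` as an iterated integral. -/
theorem volume_upper_region_inter_box {t : ℝ} (ht : 0 ≤ t) (ht' : t < 1 / 2) {x : ℝ × ℝ}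
    (hx : x ∈ I2) :
    (volume ({p ∈ I2 | (1 - p.1) * t + 1 / 2 ≤ p.2} ∩ Set.Icc 0 x)).toReal
      = ∫ u in (0 : ℝ)..x.1, max 0 (x.2 - 1 / 2 - t + t * u) := by
  obtain ⟨⟨hx0, hx2⟩, hy0, hy1⟩ := hx
  have hmeas : MeasurableSet ({p ∈ I2 | (1 - p.1) * t + 1 / 2 ≤ p.2} ∩ Set.Icc 0 x) := by
    refine (MeasurableSet.inter ?_ ?_).inter measurableSet_Icc
    · exact measurableSet_Icc.prod measurableSet_Icc
    · exact measurableSet_le (f := fun p : ℝ × ℝ => (1 - p.1) * t + 1 / 2) (by fun_prop)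
        measurable_snd
  have hslice : ∀ u, volume (Prod.mk u ⁻¹'
      ({p ∈ I2 | (1 - p.1) * t + 1 / 2 ≤ p.2} ∩ Set.Icc 0 x)) =
      (Icc 0 x.1).indicator
        (fun u => ENNReal.ofReal (max 0 (x.2 - 1 / 2 - t + t * u))) u := by
    intro u
    by_cases hu : u ∈ Icc 0 x.1
    · rw [indicator_of_mem hu]
      have : Prod.mk u ⁻¹' ({p ∈ I2 | (1 - p.1) * t + 1 / 2 ≤ p.2} ∩ Set.Icc 0 x)
          = Icc ((1 - u) * t + 1 / 2) x.2 := by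
        ext v
        have := hu.1
        have := hu.2
        simp only [I2, mem_preimage, mem_inter_iff, mem_ofPred_eq, mem_prod, mem_Icc, Prod.le_def,
          Prod.fst_zero, Prod.snd_zero]
        constructor
        · rintro ⟨⟨_, h⟩, _, _, h'⟩
          exact ⟨h, h'⟩
        · rintro ⟨h, h'⟩
          have : 0 ≤ v := by nlinarith
          refine ⟨⟨⟨⟨?_, ?_⟩, ?_, ?_⟩, h⟩, ⟨?_, ?_⟩, ?_, h'⟩ <;> linarith
      rw [this, Real.volume_Icc, ENNReal.ofReal_max, ENNReal.ofReal_zero, max_eq_right zero_le]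
      congr 1
      ring
    · rw [indicator_of_notMem hu]
      convert measure_empty (μ := volume)
      ext v
      simp only [mem_preimage, mem_inter_iff, mem_Icc, Prod.le_def, mem_empty_iff_false, iff_false]
      exact fun h => hu ⟨h.2.1.1, h.2.2.1⟩
  rw [Measure.volume_eq_prod, Measure.prod_apply hmeas, lintegral_congr hslice,
    lintegral_indicator measurableSet_Icc,
    ← ofReal_integral_eq_lintegral_ofReal, intervalIntegral.integral_of_le hx0,
    integral_Icc_eq_integral_Ioc, ENNReal.toReal_ofReal]
  · exact integral_nonneg fun u => le_max_left _ _
  · exact (by fun_prop : Continuous fun u => max 0 (x.2 - 1 / 2 - t + t * u)).integrableOn_Icc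
  · exact Filter.Eventually.of_forall fun u => le_max_left _ _

/-- For `0 ≤ θ < arctan (1/2)` and the region
`Ω₂'(θ) = {(x₁,x₂) ∈ I : x₂ ≥ (1-x₁)·tan θ + 1/2}` of `I = [0,2] × [0,1]`:
`∫_I λ(Ω₂'(θ) ∩ [0,x])² dx = 1/9 - (1/6)·tan θ + (2/15)·tan² θ + (2/45)·tan³ θ`. -/
theorem integral_measure_upper_region_inter_box_sq (θ : ℝ)
    (h1 : 0 ≤ θ) (h2 : θ < arctan (1 / 2)) :
    ∫ x in I2, ((volume ({p ∈ I2 | (1 - p.1) * tan θ + 1 / 2 ≤ p.2} ∩ Set.Icc 0 x)).toReal) ^ 2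
      = 1 / 9 - (1 / 6) * tan θ + (2 / 15) * tan θ ^ 2 + (2 / 45) * tan θ ^ 3 := by
  have hθ : θ < π / 2 := h2.trans (arctan_lt_pi_div_two _)
  have ht : 0 ≤ tan θ := tan_nonneg_of_nonneg_of_le_pi_div_two h1 hθ.le
  have ht' : tan θ < 1 / 2 := by
    rw [← tan_arctan (1 / 2)]
    exact tan_lt_tan_of_lt_of_lt_pi_div_two (by linarith [pi_pos]) (arctan_lt_pi_div_two _) h2
  generalize tan θ = t at ht ht' ⊢
  have hI : MeasurableSet I2 := measurableSet_Icc.prod measurableSet_Icc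
  have hcont : Continuous fun x : ℝ × ℝ =>
      (∫ u in (0 : ℝ)..x.1, max 0 (x.2 - 1 / 2 - t + t * u)) ^ 2 := by
    refine Continuous.pow (intervalIntegral.continuous_parametric_intervalIntegral_of_continuous
      (f := fun (x : ℝ × ℝ) u => max 0 (x.2 - 1 / 2 - t + t * u)) ?_ continuous_fst) 2
    fun_prop
  have hint := hcont.continuousOn.integrableOn_compact (μ := volume)
    ((isCompact_Icc (a := (0 : ℝ)) (b := 2)).prod (isCompact_Icc (a := (0 : ℝ)) (b := 1)))
  rw [setIntegral_congr_fun hI fun x hx =>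
      congrArg (· ^ 2) (volume_upper_region_inter_box ht ht' hx),
    ← integral_integral_sq_primitive_max_zero ht ht', I2]
  rw [Measure.volume_eq_prod, IntegrableOn, ← Measure.prod_restrict] at hint
  rw [Measure.volume_eq_prod, ← Measure.prod_restrict, integral_prod_symm _ hint,
    intervalIntegral.integral_of_le zero_le_one, integral_Icc_eq_integral_Ioc]
  simp only [intervalIntegral.integral_of_le zero_le_two, integral_Icc_eq_integral_Ioc]
end

section
/- Let m ≥ 1 and d ≥ 1 be integers and N = m^d. Let Ω*_| be the partition of [0,1]^d into the N axis-parallel grid cubes of side 1/m, and let P_{Ω*_|} be the corresponding jittered (stratified) sample. Then 𝔼L₂²(P_{Ω*_|}) ≤ d/N^{1+1/d}. -/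
open MeasureTheory Real Set

noncomputable section

/-- The unit cube `[0,1]^d`. -/
def unitCube (d : ℕ) : Set (Fin d → ℝ) := Set.univ.pi fun _ => Set.Icc (0 : ℝ) 1

/-- The anchored half-open box `[0, z) = ∏ⱼ [0, zⱼ)`. -/
def lowerBox {d : ℕ} (z : Fin d → ℝ) : Set (Fin d → ℝ) := {y | ∀ i, 0 ≤ y i ∧ y i < z i}

/-- The squared `L₂`-discrepancy of a point configuration `P` in `[0,1]^d`:
`∫_{[0,1]^d} (λ([0,z)) - (1/N) #{i : P i ∈ [0,z)})² dz`. -/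
def L2sq {d : ℕ} {ι : Type} [Fintype ι] (P : ι → Fin d → ℝ) : ℝ :=
  ∫ z in unitCube d,
    ((volume (lowerBox z)).toReal
      - (Fintype.card ι : ℝ)⁻¹ * (Nat.card {i // P i ∈ lowerBox z} : ℝ)) ^ 2

/-- The joint distribution of the stratified sample associated to a partition `Ω`:
independent points, the `i`-th uniformly distributed on `Ω i`. -/
def stratified {d : ℕ} {ι : Type} [Fintype ι] (Ω : ι → Set (Fin d → ℝ)) :
    Measure (ι → Fin d → ℝ) :=
  Measure.pi fun i => ProbabilityTheory.cond volume (Ω i)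

/-- Expected squared `L₂`-discrepancy of the stratified sample from the partition `Ω`. -/
def expL2sq {d : ℕ} {ι : Type} [Fintype ι] (Ω : ι → Set (Fin d → ℝ)) : ℝ :=
  ∫ P, L2sq P ∂(stratified Ω)

open scoped Classical in
/-- The cell `Ω₁(θ)` of the one-parameter family of partitions of `[0,2] × [0,1]`. -/
def Omega1 (θ : ℝ) : Set (ℝ × ℝ) :=
  if θ = π / 2 then Set.Icc (0 : ℝ) 1 ×ˢ Set.Icc (0 : ℝ) 1
  else if θ < arctan (1 / 2) then {p ∈ I2 | p.2 ≤ (1 - p.1) * tan θ + 1 / 2}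
  else {p ∈ I2 | (p.1 - 1) * tan θ + p.2 ≤ 1 / 2}

/-- The cell `Ω₂(θ)`: the closure of the complement of `Ω₁(θ)` in `[0,2] × [0,1]`. -/
def Omega2 (θ : ℝ) : Set (ℝ × ℝ) := closure (I2 \ Omega1 θ)

/-- The anchor point `a = ((m-2)/m, (m-1)/m, …, (m-1)/m)`. -/
def anchor (m d : ℕ) : Fin d → ℝ := fun j => if (j : ℕ) = 0 then ((m : ℝ) - 2) / m else ((m : ℝ) - 1) / m

/-- The two corner cells `a + (1/m)·(Ωᵢ(θ) × [0,1]^{d-2})`, `i = 1, 2`. -/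
def cornerCell (m d : ℕ) (hd : 2 ≤ d) (θ : ℝ) (i : Fin 2) : Set (Fin d → ℝ) :=
  (fun x : Fin d → ℝ => fun j => anchor m d j + x j / m) ''
    {x : Fin d → ℝ |
      (x ⟨0, by omega⟩, x ⟨1, by omega⟩) ∈ (if i = 0 then Omega1 θ else Omega2 θ) ∧
      ∀ j : Fin d, 2 ≤ (j : ℕ) → x j ∈ Set.Icc (0 : ℝ) 1}

/-- The axis-parallel grid cell of side `1/m` indexed by `k`. -/
def gridCell {d : ℕ} (m : ℕ) (k : Fin d → Fin m) : Set (Fin d → ℝ) :=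
  Set.univ.pi fun j => Set.Ico ((k j : ℝ) / m) (((k j : ℝ) + 1) / m)

open scoped Classical in
/-- The partition `Ω*∼(θ)` of `[0,1]^d`: all grid cells of side `1/m` except the two
top-corner ones, which are replaced by the two cells `a + (1/m)·(Ωᵢ(θ) × [0,1]^{d-2})`. -/
def OmegaStarSim (m d : ℕ) (hd : 2 ≤ d) (θ : ℝ) : (Fin d → Fin m) → Set (Fin d → ℝ) :=
  fun k =>
    if ∀ j : Fin d, (k j : ℕ) = (if (j : ℕ) = 0 then m - 2 else m - 1) then
      cornerCell m d hd θ 0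
    else if ∀ j : Fin d, (k j : ℕ) = m - 1 then cornerCell m d hd θ 1
    else gridCell m k

end

/-- A point lies in the grid cell `k` iff its scaled coordinates have integer parts `k`. -/
lemma mem_gridCell_iff {m d : ℕ} (hm : 1 ≤ m) (k : Fin d → Fin m) (y : Fin d → ℝ) :
    y ∈ gridCell m k ↔ ∀ j, ⌊(m : ℝ) * y j⌋ = ((k j : ℕ) : ℤ) := by
  have hm_pos : (0 : ℝ) < m := by exact_mod_cast hm
  simp only [gridCell, Set.mem_univ_pi, Set.mem_Ico, Int.floor_eq_iff, div_le_iff₀ hm_pos,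
    lt_div_iff₀ hm_pos, Int.cast_natCast, mul_comm (m : ℝ)]

lemma measurableSet_gridCell {m d : ℕ} (k : Fin d → Fin m) : MeasurableSet (gridCell m k) :=
  MeasurableSet.univ_pi fun _ => measurableSet_Ico

lemma volume_gridCell {m d : ℕ} (k : Fin d → Fin m) :
    volume (gridCell m k) = ENNReal.ofReal (1 / m) ^ d := by
  simp [gridCell, Real.volume_pi_Ico, ← sub_div]

lemma pairwise_disjoint_gridCell {m d : ℕ} (hm : 1 ≤ m) :
    Pairwise (Function.onFun Disjoint fun k : Fin d → Fin m => gridCell m k) := by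
  intro k l hkl
  refine Set.disjoint_left.2 fun y hk hl => hkl ?_
  rw [mem_gridCell_iff hm] at hk hl
  ext j
  exact_mod_cast (hk j).symm.trans (hl j)

lemma measurableSet_lowerBox {d : ℕ} (z : Fin d → ℝ) : MeasurableSet (lowerBox z) := by
  have h : lowerBox z = Set.univ.pi fun j => Set.Ico 0 (z j) := by
    ext y; simp [lowerBox]
  rw [h]
  exact MeasurableSet.univ_pi fun _ => measurableSet_Ico

lemma lowerBox_subset_iUnion_gridCell {m d : ℕ} (hm : 1 ≤ m) {z : Fin d → ℝ}
    (hz : z ∈ unitCube d) : lowerBox z ⊆ ⋃ k : Fin d → Fin m, gridCell m k := by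
  have hm_pos : (0 : ℝ) < m := by exact_mod_cast hm
  intro y hy
  have h0 : ∀ j, 0 ≤ (m : ℝ) * y j := fun j => mul_nonneg hm_pos.le (hy j).1
  have h1 : ∀ j, ⌊(m : ℝ) * y j⌋₊ < m := fun j => by
    rw [Nat.floor_lt (h0 j)]
    have h : y j < 1 := (hy j).2.trans_le (hz j (Set.mem_univ j)).2
    nlinarith
  refine Set.mem_iUnion.2 ⟨fun j => ⟨_, h1 j⟩, ?_⟩
  rw [mem_gridCell_iff hm]
  exact fun j => (Int.natCast_floor_eq_floor (h0 j)).symm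

/-- A grid cell that no face of `[0, z)` meets is contained in `[0, z)` or disjoint from it. -/
lemma gridCell_subset_or_disjoint_lowerBox {m d : ℕ} (hm : 1 ≤ m) (k : Fin d → Fin m)
    {z : Fin d → ℝ} (h : ∀ j, ⌊(m : ℝ) * z j⌋ ≠ ((k j : ℕ) : ℤ)) :
    gridCell m k ⊆ lowerBox z ∨ Disjoint (gridCell m k) (lowerBox z) := by
  have hm_pos : (0 : ℝ) < m := by exact_mod_cast hm
  by_cases hlt : ∃ j, ⌊(m : ℝ) * z j⌋ < ((k j : ℕ) : ℤ)
  · obtain ⟨j, hj⟩ := hlt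
    refine Or.inr (Set.disjoint_left.2 fun y hy hyz => ?_)
    rw [mem_gridCell_iff hm] at hy
    rw [← hy j] at hj
    exact hj.not_ge (Int.floor_mono (mul_le_mul_of_nonneg_left (hyz j).2.le hm_pos.le))
  · push Not at hlt
    refine Or.inl fun y hy j => ?_
    rw [mem_gridCell_iff hm] at hy
    have hyz : ⌊(m : ℝ) * y j⌋ < ⌊(m : ℝ) * z j⌋ := hy j ▸ lt_of_le_of_ne (hlt j) (h j).symm
    have h0 : 0 ≤ (m : ℝ) * y j := Int.floor_nonneg.1 (hy j ▸ Int.natCast_nonneg _)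
    exact ⟨nonneg_of_mul_nonneg_right h0 hm_pos,
      lt_of_mul_lt_mul_left (lt_of_not_ge fun h => hyz.not_ge (Int.floor_mono h)) hm_pos.le⟩

/-- At most `m ^ (d - 1)` multi-indices have a prescribed `j`-th entry. -/
lemma card_filter_apply_eq_le {m d : ℕ} (j : Fin d) (a : ℤ) :
    (Finset.univ.filter fun k : Fin d → Fin m => a = ((k j : ℕ) : ℤ)).card ≤ m ^ (d - 1) := by
  have hcard : (Finset.univ : Finset ({i : Fin d // i ≠ j} → Fin m)).card = m ^ (d - 1) := by
    simp [Fintype.card_subtype_compl]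
  rw [← hcard]
  refine Finset.card_le_card_of_injOn (fun k i => k i)
    (fun _ _ => Finset.mem_coe.2 (Finset.mem_univ _)) ?_
  intro k hk l hl hkl
  simp only [Finset.coe_filter, Finset.mem_univ, true_and, Set.mem_ofPred_eq] at hk hl
  funext i
  by_cases hi : i = j
  · subst hi
    exact Fin.ext (by exact_mod_cast hk.symm.trans hl)
  · exact congrFun hkl ⟨i, hi⟩

lemma isProbabilityMeasure_cond_gridCell {m d : ℕ} (hm : 1 ≤ m) (k : Fin d → Fin m) :
    IsProbabilityMeasure (ProbabilityTheory.cond volume (gridCell m k)) := by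
  have hm_pos : (0 : ℝ) < m := by exact_mod_cast hm
  apply ProbabilityTheory.cond_isProbabilityMeasure_of_finite
  · rw [volume_gridCell]
    exact pow_ne_zero _ (ENNReal.ofReal_pos.2 (by positivity)).ne'
  · rw [volume_gridCell]
    exact ENNReal.pow_ne_top ENNReal.ofReal_ne_top

/-- The volume of `[0, z)` is the average over the grid cells of its conditional measures. -/
lemma volume_lowerBox_eq_average {m d : ℕ} (hm : 1 ≤ m) {z : Fin d → ℝ} (hz : z ∈ unitCube d) :
    (volume (lowerBox z)).toReal = ((m : ℝ) ^ d)⁻¹ *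
      ∑ k : Fin d → Fin m, (ProbabilityTheory.cond volume (gridCell m k)).real (lowerBox z) := by
  have hm_pos : (0 : ℝ) < m := by exact_mod_cast hm
  have hunion : lowerBox z = ⋃ k : Fin d → Fin m, gridCell m k ∩ lowerBox z := by
    rw [← Set.iUnion_inter, Set.inter_eq_right.2 (lowerBox_subset_iUnion_gridCell hm hz)]
  have hfin : ∀ k : Fin d → Fin m, volume (gridCell m k ∩ lowerBox z) ≠ ⊤ := fun k =>
    measure_ne_top_of_subset Set.inter_subset_left
      (by rw [volume_gridCell]; exact ENNReal.pow_ne_top ENNReal.ofReal_ne_top)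
  conv_lhs => rw [hunion]
  rw [measure_iUnion (fun k l hkl => (pairwise_disjoint_gridCell hm hkl).mono
    Set.inter_subset_left Set.inter_subset_left)
    fun k => (measurableSet_gridCell k).inter (measurableSet_lowerBox z), tsum_fintype,
    ENNReal.toReal_sum fun k _ => hfin k, Finset.mul_sum]
  refine Finset.sum_congr rfl fun k _ => ?_
  rw [Measure.real, ProbabilityTheory.cond_apply (measurableSet_gridCell k), volume_gridCell,
    ENNReal.toReal_mul, ENNReal.toReal_inv, ENNReal.toReal_pow,
    ENNReal.toReal_ofReal (by positivity), ← mul_assoc]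
  have : ((m : ℝ) ^ d)⁻¹ * ((1 / (m : ℝ)) ^ d)⁻¹ = 1 := by
    rw [← mul_inv, ← mul_pow, mul_one_div_cancel hm_pos.ne', one_pow, inv_one]
  rw [this, one_mul]

open scoped Classical in
/-- The indicator of `[0, z)` has variance at most `1` on a grid cell met by one of the faces
of `[0, z)` and variance `0` on every other grid cell. -/
lemma variance_indicator_lowerBox_le {m d : ℕ} (hm : 1 ≤ m) (k : Fin d → Fin m)
    (z : Fin d → ℝ) :
    ProbabilityTheory.variance ((lowerBox z).indicator (1 : (Fin d → ℝ) → ℝ))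
      (ProbabilityTheory.cond volume (gridCell m k))
      ≤ if ∃ j, ⌊(m : ℝ) * z j⌋ = ((k j : ℕ) : ℤ) then 1 else 0 := by
  have := isProbabilityMeasure_cond_gridCell hm k
  have hB := measurableSet_lowerBox z
  split_ifs with h
  · refine (ProbabilityTheory.variance_le_expectation_sq
      (measurable_one.indicator hB).aestronglyMeasurable).trans ?_
    have hsq : ((lowerBox z).indicator (1 : (Fin d → ℝ) → ℝ)) ^ 2
        = (lowerBox z).indicator (1 : (Fin d → ℝ) → ℝ) := by
      funext y
      by_cases hy : y ∈ lowerBox z <;> simp [hy]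
    rw [hsq, integral_indicator_one hB]
    exact measureReal_le_one
  · push Not at h
    have hmem := ProbabilityTheory.ae_cond_mem (μ := (volume : Measure (Fin d → ℝ)))
      (measurableSet_gridCell k)
    have hconst : ∃ c : ℝ, (lowerBox z).indicator (1 : (Fin d → ℝ) → ℝ)
        =ᵐ[ProbabilityTheory.cond volume (gridCell m k)] fun _ => c := by
      rcases gridCell_subset_or_disjoint_lowerBox hm k h with hsub | hdisj
      · refine ⟨1, ?_⟩
        filter_upwards [hmem] with y hy
        simp [hsub hy]
      · refine ⟨0, ?_⟩
        filter_upwards [hmem] with y hy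
        simp [Set.disjoint_left.1 hdisj hy]
    obtain ⟨c, hc⟩ := hconst
    rw [ProbabilityTheory.variance_congr hc, ProbabilityTheory.variance_eq_integral (by fun_prop)]
    simp

lemma sum_variance_indicator_lowerBox_le {m d : ℕ} (hm : 1 ≤ m) (z : Fin d → ℝ) :
    ∑ k : Fin d → Fin m,
      ProbabilityTheory.variance ((lowerBox z).indicator (1 : (Fin d → ℝ) → ℝ))
        (ProbabilityTheory.cond volume (gridCell m k)) ≤ d * (m : ℝ) ^ (d - 1) := by
  classical
  refine (Finset.sum_le_sum fun k _ => variance_indicator_lowerBox_le hm k z).trans ?_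
  rw [Finset.sum_boole]
  have hcard : (Finset.univ.filter fun k : Fin d → Fin m =>
      ∃ j, ⌊(m : ℝ) * z j⌋ = ((k j : ℕ) : ℤ)).card ≤ d * m ^ (d - 1) := by
    calc _ ≤ (Finset.univ.biUnion fun j => Finset.univ.filter fun k : Fin d → Fin m =>
          ⌊(m : ℝ) * z j⌋ = ((k j : ℕ) : ℤ)).card :=
          Finset.card_le_card fun k hk => by simpa using hk
      _ ≤ (Finset.univ : Finset (Fin d)).card * m ^ (d - 1) :=
          Finset.card_biUnion_le_card_mul _ _ _ fun j _ => card_filter_apply_eq_le j _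
      _ = d * m ^ (d - 1) := by simp
  exact_mod_cast hcard

lemma natCard_mem_eq_sum_indicator {α ι : Type*} [Fintype ι] (P : ι → α) (B : Set α) :
    (Nat.card {i // P i ∈ B} : ℝ) = ∑ i, B.indicator (1 : α → ℝ) (P i) := by
  classical
  simp [Set.indicator_apply, Fintype.card_subtype]

/-- The mean squared local discrepancy of the jittered sample at `z`. -/
lemma integral_sq_localDiscrepancy_le {m d : ℕ} (hm : 1 ≤ m) {z : Fin d → ℝ}
    (hz : z ∈ unitCube d) :
    ∫ P, ((volume (lowerBox z)).toReal - ((m : ℝ) ^ d)⁻¹ *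
        ∑ k, (lowerBox z).indicator (1 : (Fin d → ℝ) → ℝ) (P k)) ^ 2
        ∂(stratified fun k : Fin d → Fin m => gridCell m k)
      ≤ (((m : ℝ) ^ d)⁻¹) ^ 2 * (d * (m : ℝ) ^ (d - 1)) := by
  have hprob := fun k : Fin d → Fin m => isProbabilityMeasure_cond_gridCell hm k
  have hB := measurableSet_lowerBox z
  have hX : Measurable ((lowerBox z).indicator (1 : (Fin d → ℝ) → ℝ)) :=
    measurable_one.indicator hB
  have hmem : ∀ k : Fin d → Fin m, MemLp ((lowerBox z).indicator (1 : (Fin d → ℝ) → ℝ)) 2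
      (ProbabilityTheory.cond volume (gridCell m k)) := fun k =>
    (memLp_const (1 : ℝ)).indicator hB
  have hvar := ProbabilityTheory.variance_sum_pi hmem
  have hint : ∀ k : Fin d → Fin m, ∫ P : (Fin d → Fin m) → Fin d → ℝ,
      (lowerBox z).indicator (1 : (Fin d → ℝ) → ℝ) (P k)
        ∂Measure.pi (fun k : Fin d → Fin m => ProbabilityTheory.cond volume (gridCell m k))
      = (ProbabilityTheory.cond volume (gridCell m k)).real (lowerBox z) := fun k => by
    rw [integral_comp_eval (μ := fun k : Fin d → Fin m =>
      ProbabilityTheory.cond volume (gridCell m k)) hX.aestronglyMeasurable,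
      integral_indicator_one hB]
  have hmean : ∫ P : (Fin d → Fin m) → Fin d → ℝ,
      (∑ k, fun P : (Fin d → Fin m) → Fin d → ℝ =>
        (lowerBox z).indicator (1 : (Fin d → ℝ) → ℝ) (P k)) P
        ∂Measure.pi (fun k : Fin d → Fin m => ProbabilityTheory.cond volume (gridCell m k))
      = ∑ k, (ProbabilityTheory.cond volume (gridCell m k)).real (lowerBox z) := by
    simp only [Finset.sum_apply]
    rw [integral_finsetSum]
    · exact Finset.sum_congr rfl fun k _ => hint k
    · exact fun k _ => integrable_comp_eval ((hmem k).integrable one_le_two)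
  have hsum : Measurable (∑ k, fun P : (Fin d → Fin m) → Fin d → ℝ =>
      (lowerBox z).indicator (1 : (Fin d → ℝ) → ℝ) (P k)) := by
    rw [Finset.sum_fn]
    exact Finset.measurable_sum _ fun k _ => hX.comp (measurable_pi_apply k)
  rw [ProbabilityTheory.variance_eq_integral hsum.aemeasurable, hmean] at hvar
  refine le_trans (le_of_eq ?_) (mul_le_mul_of_nonneg_left
    (sum_variance_indicator_lowerBox_le hm z) (sq_nonneg _))
  rw [← hvar, stratified, ← integral_const_mul, volume_lowerBox_eq_average hm hz]
  congr 1
  funext P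
  simp only [Finset.sum_apply]
  ring

lemma volume_lowerBox {d : ℕ} (z : Fin d → ℝ) :
    volume (lowerBox z) = ∏ j, ENNReal.ofReal (z j) := by
  have h : lowerBox z = Set.univ.pi fun j => Set.Ico ((0 : Fin d → ℝ) j) (z j) := by
    ext y; simp [lowerBox]
  rw [h, Real.volume_pi_Ico]
  simp

lemma measurable_localDiscrepancy {ι : Type} [Fintype ι] {d : ℕ} (c : ℝ) :
    Measurable fun q : (ι → Fin d → ℝ) × (Fin d → ℝ) => (volume (lowerBox q.2)).toReal -
      c * ∑ i, (lowerBox q.2).indicator (1 : (Fin d → ℝ) → ℝ) (q.1 i) := by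
  have hvol : Measurable fun q : (ι → Fin d → ℝ) × (Fin d → ℝ) =>
      (volume (lowerBox q.2)).toReal := by
    simp only [volume_lowerBox]
    fun_prop
  have hind : ∀ i : ι, Measurable fun q : (ι → Fin d → ℝ) × (Fin d → ℝ) =>
      (lowerBox q.2).indicator (1 : (Fin d → ℝ) → ℝ) (q.1 i) := fun i => by
    have hset : MeasurableSet {q : (ι → Fin d → ℝ) × (Fin d → ℝ) | q.1 i ∈ lowerBox q.2} := by
      have h : {q : (ι → Fin d → ℝ) × (Fin d → ℝ) | q.1 i ∈ lowerBox q.2}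
          = ⋂ j, {q | 0 ≤ q.1 i j} ∩ {q | q.1 i j < q.2 j} := by
        ext q; simp [lowerBox]
      rw [h]
      exact MeasurableSet.iInter fun j => MeasurableSet.inter
        (measurableSet_le (by fun_prop) (by fun_prop))
        (measurableSet_lt (by fun_prop) (by fun_prop))
    exact measurable_one.indicator hset
  exact hvol.sub ((Finset.measurable_fun_sum _ fun i _ => hind i).const_mul c)

lemma volume_unitCube (d : ℕ) : volume (unitCube d) = 1 := by
  rw [unitCube, volume_pi_pi]
  simp

lemma measurableSet_unitCube (d : ℕ) : MeasurableSet (unitCube d) :=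
  MeasurableSet.univ_pi fun _ => measurableSet_Icc

lemma integrable_sq_localDiscrepancy {ι : Type} [Fintype ι] {d : ℕ} (c : ℝ)
    (μ : Measure (ι → Fin d → ℝ)) [IsFiniteMeasure μ] :
    Integrable (fun q : (ι → Fin d → ℝ) × (Fin d → ℝ) => ((volume (lowerBox q.2)).toReal -
      c * ∑ i, (lowerBox q.2).indicator (1 : (Fin d → ℝ) → ℝ) (q.1 i)) ^ 2)
      (μ.prod (volume.restrict (unitCube d))) := by
  have : IsFiniteMeasure (volume.restrict (unitCube d)) :=
    isFiniteMeasure_restrict.2 (by simp [volume_unitCube])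
  refine Integrable.of_bound ((measurable_localDiscrepancy c).pow_const 2).aestronglyMeasurable
    ((1 + |c| * Fintype.card ι) ^ 2) ?_
  filter_upwards [Measure.quasiMeasurePreserving_snd.ae
    (ae_restrict_mem (measurableSet_unitCube d))] with q hq
  have hvol : (volume (lowerBox q.2)).toReal ≤ 1 := by
    refine ENNReal.toReal_le_of_le_ofReal zero_le_one ?_
    rw [volume_lowerBox, ENNReal.ofReal_one]
    exact Finset.prod_le_one' fun j _ => ENNReal.ofReal_le_one.2 (hq j (Set.mem_univ j)).2
  have hsum : |∑ i, (lowerBox q.2).indicator (1 : (Fin d → ℝ) → ℝ) (q.1 i)|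
      ≤ Fintype.card ι := by
    rw [← natCard_mem_eq_sum_indicator, Nat.abs_cast, ← Nat.card_eq_fintype_card]
    exact_mod_cast Finite.card_subtype_le _
  rw [norm_pow, Real.norm_eq_abs]
  gcongr
  refine (abs_sub _ _).trans ?_
  rw [abs_mul, abs_of_nonneg ENNReal.toReal_nonneg]
  gcongr

/-- For integers `m, d ≥ 1` and `N = m^d`, the jittered (stratified)
sample from the partition of `[0,1]^d` into the `N` axis-parallel grid cubes of side `1/m`
satisfies `𝔼L₂² ≤ d / N^(1 + 1/d)`. -/
theorem expL2sq_jittered_le (m d : ℕ) (hm : 1 ≤ m) (hd : 1 ≤ d) :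
    expL2sq (fun k : Fin d → Fin m => gridCell m k)
      ≤ (d : ℝ) / ((m : ℝ) ^ d) ^ ((1 : ℝ) + 1 / d) := by
  have hprob := fun k : Fin d → Fin m => isProbabilityMeasure_cond_gridCell hm k
  have : IsFiniteMeasure (stratified fun k : Fin d → Fin m => gridCell m k) := by
    unfold stratified; infer_instance
  have hm_pos : (0 : ℝ) < m := by exact_mod_cast hm
  have hd_pos : (0 : ℝ) < d := by exact_mod_cast hd
  have hcard : (Fintype.card (Fin d → Fin m) : ℝ) = (m : ℝ) ^ d := by simp
  simp only [expL2sq, L2sq, natCard_mem_eq_sum_indicator, hcard]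
  rw [integral_integral_swap (integrable_sq_localDiscrepancy _ _)]
  calc _ ≤ ∫ _ in unitCube d, (((m : ℝ) ^ d)⁻¹) ^ 2 * (d * (m : ℝ) ^ (d - 1)) := by
        exact setIntegral_mono_on (integrable_sq_localDiscrepancy _ _).integral_prod_right
          (integrableOn_const (by simp [volume_unitCube])) (measurableSet_unitCube d)
          fun z hz => integral_sq_localDiscrepancy_le hm hz
    _ = (d : ℝ) / ((m : ℝ) ^ d) ^ ((1 : ℝ) + 1 / d) := by
        have hpow : ((m : ℝ) ^ d) ^ ((1 : ℝ) + 1 / d) = (m : ℝ) ^ (d + 1) := by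
          rw [← Real.rpow_natCast, ← Real.rpow_mul hm_pos.le, ← Real.rpow_natCast]
          congr 1
          push_cast
          field_simp
        rw [hpow, setIntegral_const, Measure.real, volume_unitCube]
        obtain ⟨n, rfl⟩ := Nat.exists_eq_add_of_le' hd
        simp only [Nat.add_sub_cancel, ENNReal.toReal_one, smul_eq_mul, one_mul]
        field_simp
        ring
end

section
/- The function P: [0,π/2] → ℝ defined piecewise by P(θ) = (2/45)tan³θ + (2/15)tan²θ − (1/6)tanθ for 0 ≤ θ < arctan(1/2), P(arctan(1/2)) = −2/45, and P(θ) = −(1/24)cotθ + (1/120)cot²θ + (1/1440)cot³θ for arctan(1/2) < θ ≤ π/2, satisfies: (i) P is continuous on [0,π/2]; (ii) P(0) = 0 and P(π/2) = 0; (iii) P is strictly decreasing on [0, arctan(1/2)] and strictly increasing on [arctan(1/2), π/2]; (iv) P(θ) < 0 for all θ ∈ (0, π/2), with minimum value −2/45 attained exactly at θ = arctan(1/2). -/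
open Real Set

open scoped Classical in
/-- The piecewise function `P : [0, π/2] → ℝ`:
`P(θ) = (2/45)·tan³θ + (2/15)·tan²θ - (1/6)·tanθ` for `0 ≤ θ < arctan (1/2)`,
`P(arctan (1/2)) = -2/45`, and
`P(θ) = -(1/24)·cotθ + (1/120)·cot²θ + (1/1440)·cot³θ` for `arctan (1/2) < θ ≤ π/2`. -/
noncomputable def Pfun (θ : ℝ) : ℝ :=
  if θ < Real.arctan (1 / 2) then
    (2 / 45) * Real.tan θ ^ 3 + (2 / 15) * Real.tan θ ^ 2 - (1 / 6) * Real.tan θ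
  else if θ = Real.arctan (1 / 2) then -(2 / 45)
  else
    -(1 / 24) * Real.cot θ + (1 / 120) * Real.cot θ ^ 2 + (1 / 1440) * Real.cot θ ^ 3

/-- The cubic with `P = tangentCubic ∘ tan` on the left branch and
`P = tangentCubic ∘ (cot / 4)` on the right branch. -/
noncomputable def tangentCubic (t : ℝ) : ℝ :=
  (2 / 45) * t ^ 3 + (2 / 15) * t ^ 2 - (1 / 6) * t

theorem continuous_tangentCubic : Continuous tangentCubic := by
  unfold tangentCubic
  fun_prop

theorem tangentCubic_half : tangentCubic (1 / 2) = -(2 / 45) := by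
  norm_num [tangentCubic]

theorem strictAntiOn_tangentCubic : StrictAntiOn tangentCubic (Icc 0 (1 / 2)) := by
  intro x hx y hy hxy
  obtain ⟨hx0, hx1⟩ := hx
  obtain ⟨hy0, hy1⟩ := hy
  have hfactor : tangentCubic x - tangentCubic y =
      (y - x) * (1 / 6 - (2 / 45) * (x ^ 2 + x * y + y ^ 2) - (2 / 15) * (x + y)) := by
    unfold tangentCubic
    ring
  have hpos : 0 < 1 / 6 - (2 / 45) * (x ^ 2 + x * y + y ^ 2) - (2 / 15) * (x + y) := by
    nlinarith
  have := mul_pos (sub_pos.2 hxy) hpos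
  linarith

theorem Real.cot_eq_tan_pi_div_two_sub (θ : ℝ) : cot θ = tan (π / 2 - θ) := by
  rw [cot_eq_cos_div_sin, tan_eq_sin_div_cos, sin_pi_div_two_sub, cos_pi_div_two_sub]

theorem Real.strictAntiOn_cot : StrictAntiOn cot (Ioo 0 π) := by
  intro x hx y hy hxy
  rw [cot_eq_tan_pi_div_two_sub, cot_eq_tan_pi_div_two_sub]
  exact strictMonoOn_tan ⟨by linarith [hy.2], by linarith [hy.1]⟩
    ⟨by linarith [hx.2], by linarith [hx.1]⟩ (by linarith)

theorem Real.continuousOn_cot : ContinuousOn cot (Ioo 0 π) := by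
  have h : ContinuousOn (fun θ => cos θ / sin θ) (Ioo 0 π) :=
    continuous_cos.continuousOn.div continuous_sin.continuousOn
      fun θ hθ => (sin_pos_of_mem_Ioo hθ).ne'
  exact h.congr fun θ _ => cot_eq_cos_div_sin θ

theorem arctan_half_pos : 0 < arctan (1 / 2) := arctan_pos.2 (by norm_num)

theorem cot_arctan_half : cot (arctan (1 / 2)) = 2 := by
  rw [← tan_inv_eq_cot, tan_arctan]
  norm_num

theorem Pfun_arctan_half : Pfun (arctan (1 / 2)) = -(2 / 45) := by
  simp [Pfun]

theorem Pfun_eq_tangentCubic_tan {θ : ℝ} (hθ : θ ≤ arctan (1 / 2)) :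
    Pfun θ = tangentCubic (tan θ) := by
  rcases hθ.lt_or_eq with h | rfl
  · rw [Pfun, if_pos h, tangentCubic]
  · rw [Pfun_arctan_half, tan_arctan, tangentCubic_half]

theorem Pfun_eq_tangentCubic_cot {θ : ℝ} (hθ : arctan (1 / 2) ≤ θ) :
    Pfun θ = tangentCubic (cot θ / 4) := by
  rcases hθ.lt_or_eq with h | rfl
  · rw [Pfun, if_neg h.not_gt, if_neg h.ne', tangentCubic]
    ring
  · rw [Pfun_arctan_half, cot_arctan_half, ← tangentCubic_half]
    norm_num

theorem Icc_zero_arctan_half_subset :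
    Icc 0 (arctan (1 / 2)) ⊆ Ioo (-(π / 2)) (π / 2) := fun _ hθ =>
  ⟨by linarith [hθ.1, pi_pos], hθ.2.trans_lt (arctan_lt_pi_div_two _)⟩

theorem Icc_arctan_half_pi_div_two_subset :
    Icc (arctan (1 / 2)) (π / 2) ⊆ Ioo 0 π := fun _ hθ =>
  ⟨arctan_half_pos.trans_le hθ.1, by linarith [hθ.2, pi_pos]⟩

theorem mapsTo_tan_Icc :
    MapsTo tan (Icc 0 (arctan (1 / 2))) (Icc 0 (1 / 2)) := by
  intro θ hθ
  have hmono := strictMonoOn_tan.monotoneOn.mono Icc_zero_arctan_half_subset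
  have h0 := hmono (left_mem_Icc.2 arctan_half_pos.le) hθ hθ.1
  have h1 := hmono hθ (right_mem_Icc.2 arctan_half_pos.le) hθ.2
  rw [tan_zero] at h0
  rw [tan_arctan] at h1
  exact ⟨h0, h1⟩

theorem mapsTo_cot_div_four_Icc :
    MapsTo (fun θ => cot θ / 4) (Icc (arctan (1 / 2)) (π / 2)) (Icc 0 (1 / 2)) := by
  intro θ hθ
  have hle : arctan (1 / 2) ≤ π / 2 := (arctan_lt_pi_div_two _).le
  have hanti := strictAntiOn_cot.antitoneOn.mono Icc_arctan_half_pi_div_two_subset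
  have h0 := hanti hθ (right_mem_Icc.2 hle) hθ.2
  have h1 := hanti (left_mem_Icc.2 hle) hθ hθ.1
  rw [cot_eq_tan_pi_div_two_sub, sub_self, tan_zero] at h0
  rw [cot_arctan_half] at h1
  exact ⟨by linarith, by linarith⟩

theorem strictAntiOn_Pfun : StrictAntiOn Pfun (Icc 0 (arctan (1 / 2))) :=
  (strictAntiOn_tangentCubic.comp_strictMonoOn
    (strictMonoOn_tan.mono Icc_zero_arctan_half_subset) mapsTo_tan_Icc).congr
    fun _ hθ => (Pfun_eq_tangentCubic_tan hθ.2).symm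

theorem strictMonoOn_Pfun : StrictMonoOn Pfun (Icc (arctan (1 / 2)) (π / 2)) := by
  intro x hx y hy hxy
  rw [Pfun_eq_tangentCubic_cot hx.1, Pfun_eq_tangentCubic_cot hy.1]
  refine strictAntiOn_tangentCubic (mapsTo_cot_div_four_Icc hy) (mapsTo_cot_div_four_Icc hx) ?_
  have := strictAntiOn_cot (Icc_arctan_half_pi_div_two_subset hx)
    (Icc_arctan_half_pi_div_two_subset hy) hxy
  linarith

theorem continuousOn_Pfun : ContinuousOn Pfun (Icc 0 (π / 2)) := by
  rw [← Icc_union_Icc_eq_Icc arctan_half_pos.le (arctan_lt_pi_div_two (1 / 2)).le]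
  refine ContinuousOn.union_of_isClosed ?_ ?_ isClosed_Icc isClosed_Icc
  · exact (continuous_tangentCubic.comp_continuousOn
      (continuousOn_tan_Ioo.mono Icc_zero_arctan_half_subset)).congr
      fun _ hθ => Pfun_eq_tangentCubic_tan hθ.2
  · exact (continuous_tangentCubic.comp_continuousOn
      ((continuousOn_cot.mono Icc_arctan_half_pi_div_two_subset).div_const 4)).congr
      fun _ hθ => Pfun_eq_tangentCubic_cot hθ.1

theorem Pfun_zero : Pfun 0 = 0 := by
  simp [Pfun_eq_tangentCubic_tan arctan_half_pos.le, tangentCubic]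

theorem Pfun_pi_div_two : Pfun (π / 2) = 0 := by
  rw [Pfun_eq_tangentCubic_cot (arctan_lt_pi_div_two _).le, cot_eq_tan_pi_div_two_sub]
  simp [tangentCubic]

theorem Pfun_neg {θ : ℝ} (hθ : θ ∈ Ioo 0 (π / 2)) : Pfun θ < 0 := by
  rcases le_total θ (arctan (1 / 2)) with h | h
  · rw [← Pfun_zero]
    exact strictAntiOn_Pfun (left_mem_Icc.2 arctan_half_pos.le) ⟨hθ.1.le, h⟩ hθ.1
  · rw [← Pfun_pi_div_two]
    exact strictMonoOn_Pfun ⟨h, hθ.2.le⟩ (right_mem_Icc.2 (arctan_lt_pi_div_two _).le) hθ.2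

theorem Pfun_arctan_half_lt {θ : ℝ} (hθ : θ ∈ Icc 0 (π / 2)) (hne : θ ≠ arctan (1 / 2)) :
    Pfun (arctan (1 / 2)) < Pfun θ := by
  rcases hne.lt_or_gt with h | h
  · exact strictAntiOn_Pfun ⟨hθ.1, h.le⟩ (right_mem_Icc.2 arctan_half_pos.le) h
  · exact strictMonoOn_Pfun (left_mem_Icc.2 (arctan_lt_pi_div_two _).le) ⟨h.le, hθ.2⟩ h

/-- The piecewise function `P` satisfies:
(i) `P` is continuous on `[0, π/2]`;
(ii) `P(0) = 0` and `P(π/2) = 0`;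
(iii) `P` is strictly decreasing on `[0, arctan (1/2)]` and strictly increasing on
`[arctan (1/2), π/2]`;
(iv) `P(θ) < 0` for all `θ ∈ (0, π/2)`, with minimum value `-2/45` attained exactly at
`θ = arctan (1/2)`. -/
theorem Pfun_properties :
    ContinuousOn Pfun (Set.Icc 0 (π / 2))
    ∧ (Pfun 0 = 0 ∧ Pfun (π / 2) = 0)
    ∧ (StrictAntiOn Pfun (Set.Icc 0 (arctan (1 / 2)))
        ∧ StrictMonoOn Pfun (Set.Icc (arctan (1 / 2)) (π / 2)))
    ∧ ((∀ θ ∈ Set.Ioo 0 (π / 2), Pfun θ < 0)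
        ∧ Pfun (arctan (1 / 2)) = -(2 / 45)
        ∧ (∀ θ ∈ Set.Icc 0 (π / 2), -(2 / 45) ≤ Pfun θ)
        ∧ ∀ θ ∈ Set.Icc 0 (π / 2), Pfun θ = -(2 / 45) → θ = arctan (1 / 2)) := by
  refine ⟨continuousOn_Pfun, ⟨Pfun_zero, Pfun_pi_div_two⟩, ⟨strictAntiOn_Pfun, strictMonoOn_Pfun⟩,
    fun _ => Pfun_neg, Pfun_arctan_half, fun θ hθ => ?_, fun θ hθ hP => ?_⟩
  · rw [← Pfun_arctan_half]
    rcases eq_or_ne θ (arctan (1 / 2)) with rfl | hne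
    · exact le_rfl
    · exact (Pfun_arctan_half_lt hθ hne).le
  · by_contra hne
    exact (Pfun_arctan_half_lt hθ hne).ne (Pfun_arctan_half.trans hP.symm)
end
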